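/- arXiv:1903.06395 — 5 statements merged into one kernel-verified Lean document; each statement's English description precedes it below -/
import Mathlib

section
/- Let δ, η, h, a > 0 be real parameters with h + a/η > 1 and (2ηh + 2a − 2η)/(δ(ηh + a)(ηh + δ + a)) < 1. Then every complex root of the polynomial f₂(λ) = λ³ + (ηh + δ + a)λ² + δ(ηh + a)λ + 2η(h + a/η − 1) has negative real part. (This is Proposition 1(2): the symmetric equilibria SE₂,₃ = (0, ±√(h + a/η − 1), 1) of the controlled plasma perturbation system are linearly stable, since f₂ is the characteristic polynomial of the Jacobian at SE₂,₃.) -/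
/-- The sufficient direction of the Routh–Hurwitz criterion for a monic real cubic. -/
theorem re_neg_of_cubic_eq_zero {p q r : ℝ} (hp : 0 < p) (hq : 0 < q) (hr : 0 < r)
    (hpq : r < p * q) {z : ℂ} (hz : z ^ 3 + (p : ℂ) * z ^ 2 + (q : ℂ) * z + (r : ℂ) = 0) :
    z.re < 0 := by
  obtain ⟨x, y⟩ := z
  have hre : x ^ 3 - 3 * x * y ^ 2 + p * (x ^ 2 - y ^ 2) + q * x + r = 0 := by
    have := congrArg Complex.re hz
    simp [pow_succ] at this
    linear_combination this
  have him : y * (3 * x ^ 2 - y ^ 2 + 2 * p * x + q) = 0 := by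
    have := congrArg Complex.im hz
    simp [pow_succ] at this
    linear_combination this
  change x < 0
  by_contra! hx
  rcases mul_eq_zero.mp him with rfl | hy
  · have : 0 < x ^ 3 + p * x ^ 2 + q * x + r := by positivity
    linarith
  · have hres : 8 * x ^ 3 + 8 * p * x ^ 2 + 2 * (q + p ^ 2) * x + (p * q - r) = 0 := by
      linear_combination (3 * x + p) * hy - hre
    have : 0 ≤ 8 * x ^ 3 + 8 * p * x ^ 2 + 2 * (q + p ^ 2) * x := by positivity
    linarith

/-- Proposition 1(2): if δ, η, h, a > 0, h + a/η > 1 and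
(2ηh + 2a − 2η)/(δ(ηh + a)(ηh + δ + a)) < 1, then every complex root of the
characteristic polynomial f₂(λ) = λ³ + (ηh + δ + a)λ² + δ(ηh + a)λ + 2η(h + a/η − 1)
of the Jacobian at the symmetric equilibria SE₂,₃ has negative real part. -/
theorem stmt_1 (δ η h a : ℝ) (hδ : 0 < δ) (hη : 0 < η) (hh : 0 < h) (ha : 0 < a)
    (hcond1 : 1 < h + a / η)
    (hcond2 : (2 * η * h + 2 * a - 2 * η) / (δ * (η * h + a) * (η * h + δ + a)) < 1) :
    ∀ z : ℂ, z ^ 3 + ((η * h + δ + a : ℝ) : ℂ) * z ^ 2 + ((δ * (η * h + a) : ℝ) : ℂ) * z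
        + ((2 * η * (h + a / η - 1) : ℝ) : ℂ) = 0 →
      z.re < 0 := by
  intro z hz
  have hr : 2 * η * (h + a / η - 1) = 2 * η * h + 2 * a - 2 * η := by
    field_simp
  rw [div_lt_one (by positivity)] at hcond2
  refine re_neg_of_cubic_eq_zero (by positivity) (by positivity)
    (mul_pos (by positivity) (by linarith)) ?_ hz
  rw [hr]
  linarith
end

section
/- Let δ, η, h > 0 with h > 1, and let F : ℝ³ → ℝ³ be the vector field F(x₁, x₂, x₃) = (x₂(x₃ − 1) − δx₁, x₁, η(h − x₃ − x₂²x₃)). Then F(x) = 0 if and only if x is one of the three points E₁ = (0, 0, h), E₂ = (0, √(h − 1), 1), E₃ = (0, −√(h − 1), 1). -/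
/-- The uncontrolled plasma perturbation system with δ, η, h > 0 and h > 1 has exactly
three equilibria: E₁ = (0, 0, h), E₂ = (0, √(h − 1), 1), E₃ = (0, −√(h − 1), 1). -/
theorem stmt_2 (δ η h : ℝ) (hδ : 0 < δ) (hη : 0 < η) (hh : 1 < h)
    (F : ℝ × ℝ × ℝ → ℝ × ℝ × ℝ)
    (hF : F = fun x => (x.2.1 * (x.2.2 - 1) - δ * x.1, x.1,
      η * (h - x.2.2 - x.2.1 ^ 2 * x.2.2))) :
    ∀ x : ℝ × ℝ × ℝ, F x = 0 ↔
      x = (0, 0, h) ∨ x = (0, Real.sqrt (h - 1), 1) ∨ x = (0, -Real.sqrt (h - 1), 1) := by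
  rintro ⟨a, b, c⟩
  have hs : Real.sqrt (h - 1) ^ 2 = h - 1 := Real.sq_sqrt (by linarith)
  subst hF
  simp only [Prod.mk_eq_zero, Prod.mk.injEq]
  constructor
  · rintro ⟨h₁, rfl, h₃⟩
    have h₄ : h - c - b ^ 2 * c = 0 := (mul_eq_zero.mp h₃).resolve_left hη.ne'
    have h₅ : b * (c - 1) = 0 := by linarith
    rcases mul_eq_zero.mp h₅ with rfl | hc
    · exact Or.inl ⟨rfl, rfl, by linarith⟩
    · obtain rfl : c = 1 := by linarith
      have hb : b ^ 2 = Real.sqrt (h - 1) ^ 2 := by linarith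
      rcases sq_eq_sq_iff_eq_or_eq_neg.mp hb with hb | hb
      · exact Or.inr (Or.inl ⟨rfl, hb, rfl⟩)
      · exact Or.inr (Or.inr ⟨rfl, hb, rfl⟩)
  · rintro (⟨rfl, rfl, rfl⟩ | ⟨rfl, rfl, rfl⟩ | ⟨rfl, rfl, rfl⟩)
    · simp
    · simp [hs]
    · simp [hs]
end

section
/- Let δ, η, h, a > 0 and let G : ℝ → ℝ satisfy G(0) = 1. If h + a/η ≤ 1, then the vector field F(x₁, x₂, x₃) = (x₂(x₃ − 1) − δx₁, x₁, η(h − x₃ − x₂²x₃) + a·G(x₁)) has exactly one zero, namely SE₁ = (0, 0, h + a/η). -/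
/-- If δ, η, h, a > 0, G(0) = 1 and h + a/η ≤ 1, then the controlled plasma perturbation
vector field has exactly one zero, namely SE₁ = (0, 0, h + a/η). -/
theorem stmt_3 (δ η h a : ℝ) (hδ : 0 < δ) (hη : 0 < η) (hh : 0 < h) (ha : 0 < a)
    (G : ℝ → ℝ) (hG : G 0 = 1) (hcond : h + a / η ≤ 1)
    (F : ℝ × ℝ × ℝ → ℝ × ℝ × ℝ)
    (hF : F = fun x => (x.2.1 * (x.2.2 - 1) - δ * x.1, x.1,
      η * (h - x.2.2 - x.2.1 ^ 2 * x.2.2) + a * G x.1)) :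
    ∀ x : ℝ × ℝ × ℝ, F x = 0 ↔ x = (0, 0, h + a / η) := by
  rintro ⟨x, y, z⟩
  obtain ⟨c, rfl⟩ : ∃ c, a = η * c := ⟨a / η, by field_simp⟩
  rw [mul_div_cancel_left₀ c hη.ne'] at hcond ⊢
  simp only [hF, Prod.mk_eq_zero, Prod.mk.injEq]
  constructor
  · rintro ⟨h₁, rfl, h₃⟩
    have hz : h - z - y ^ 2 * z + c = 0 := by
      rw [hG] at h₃
      exact (mul_eq_zero.mp (by linarith : η * (h - z - y ^ 2 * z + c) = 0)).resolve_left hη.ne'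
    have hy : y = 0 := by
      rcases mul_eq_zero.mp (by linarith : y * (z - 1) = 0) with hy | hz₁
      · exact hy
      · obtain rfl : z = 1 := by linarith
        exact pow_eq_zero_iff two_ne_zero |>.mp (le_antisymm (by linarith) (sq_nonneg y))
    subst hy
    exact ⟨rfl, rfl, by linarith⟩
  · rintro ⟨rfl, rfl, rfl⟩
    rw [hG]
    exact ⟨by ring, rfl, by ring⟩
end

section
/- Let δ, η, h, a > 0 and let G : ℝ → ℝ satisfy G(0) = 1. If h + a/η > 1, then the set of zeros of the vector field F(x₁, x₂, x₃) = (x₂(x₃ − 1) − δx₁, x₁, η(h − x₃ − x₂²x₃) + a·G(x₁)) is exactly the three points SE₁ = (0, 0, h + a/η), SE₂ = (0, √(h + a/η − 1), 1), SE₃ = (0, −√(h + a/η − 1), 1). -/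
/-- If δ, η, h, a > 0, G(0) = 1 and h + a/η > 1, then the zeros of the controlled plasma
perturbation vector field are exactly SE₁ = (0, 0, h + a/η),
SE₂ = (0, √(h + a/η − 1), 1) and SE₃ = (0, −√(h + a/η − 1), 1). -/
theorem stmt_4 (δ η h a : ℝ) (hδ : 0 < δ) (hη : 0 < η) (hh : 0 < h) (ha : 0 < a)
    (G : ℝ → ℝ) (hG : G 0 = 1) (hcond : 1 < h + a / η)
    (F : ℝ × ℝ × ℝ → ℝ × ℝ × ℝ)
    (hF : F = fun x => (x.2.1 * (x.2.2 - 1) - δ * x.1, x.1,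
      η * (h - x.2.2 - x.2.1 ^ 2 * x.2.2) + a * G x.1)) :
    ∀ x : ℝ × ℝ × ℝ, F x = 0 ↔
      x = (0, 0, h + a / η) ∨ x = (0, Real.sqrt (h + a / η - 1), 1) ∨
        x = (0, -Real.sqrt (h + a / η - 1), 1) := by
  subst hF
  rintro ⟨x, y, z⟩
  have hs : √(h + a / η - 1) ^ 2 = h + a / η - 1 := Real.sq_sqrt (by linarith)
  have hm : η * (a / η) = a := mul_div_cancel₀ a hη.ne'
  simp only [Prod.mk_eq_zero, Prod.mk.injEq]
  constructor
  · rintro ⟨h₁, rfl, h₃⟩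
    have h₁ : y * (z - 1) = 0 := by linarith
    have h₃ : h + a / η = z + y ^ 2 * z := by
      rw [hG] at h₃
      apply mul_left_cancel₀ hη.ne'
      linarith
    rcases mul_eq_zero.mp h₁ with rfl | hz
    · exact Or.inl ⟨rfl, rfl, by linarith⟩
    · obtain rfl : z = 1 := by linarith
      have hy : y ^ 2 = √(h + a / η - 1) ^ 2 := by linarith
      rcases sq_eq_sq_iff_eq_or_eq_neg.mp hy with hy | hy
      · exact Or.inr (Or.inl ⟨rfl, hy, rfl⟩)
      · exact Or.inr (Or.inr ⟨rfl, hy, rfl⟩)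
  · rintro (⟨rfl, rfl, rfl⟩ | ⟨rfl, rfl, rfl⟩ | ⟨rfl, rfl, rfl⟩)
    · exact ⟨by ring, rfl, by rw [hG]; linarith⟩
    · exact ⟨by ring, rfl, by rw [hG, hs]; linarith⟩
    · exact ⟨by ring, rfl, by rw [hG, neg_sq, hs]; linarith⟩
end

section
/- Let δ, η, h > 0 with h > 1 and (2ηh − 2η)/(δ·ηh·(ηh + δ)) < 1. Then every complex root of the polynomial λ³ + (ηh + δ)λ² + δηh·λ + 2η(h − 1) has negative real part. (This is the paper's claim that the uncontrolled plasma perturbation system (2) is stable at the symmetric equilibria E₂,₃ = (0, ±√(h − 1), 1) under this condition, since this polynomial is the characteristic polynomial of the Jacobian of system (2) at E₂,₃.) -/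
/-- Routh–Hurwitz criterion for real monic cubics (sufficiency). -/
theorem re_neg_of_cubic_eq_zero_s12 {a b c : ℝ} (ha : 0 < a) (hb : 0 < b) (hc : 0 < c)
    (habc : c < b * a) {z : ℂ} (hz : z ^ 3 + (a : ℂ) * z ^ 2 + (b : ℂ) * z + (c : ℂ) = 0) :
    z.re < 0 := by
  obtain ⟨x, y⟩ := z
  have hre : x ^ 3 - 3 * x * y ^ 2 + a * (x ^ 2 - y ^ 2) + b * x + c = 0 := by
    have h := congrArg Complex.re hz
    simp [pow_succ] at h
    linarith
  have him : y * (3 * x ^ 2 - y ^ 2 + 2 * a * x + b) = 0 := by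
    have h := congrArg Complex.im hz
    simp [pow_succ] at h
    linarith
  change x < 0
  by_contra! hx
  rcases mul_eq_zero.mp him with rfl | hy
  · have : 0 < x ^ 3 + a * x ^ 2 + b * x + c := by positivity
    linarith
  · have hy' : y ^ 2 = 3 * x ^ 2 + 2 * a * x + b := by linarith
    rw [hy'] at hre
    have : 0 ≤ 8 * x ^ 3 + 8 * a * x ^ 2 + 2 * (a ^ 2 + b) * x := by positivity
    linarith

/-- If δ, η, h > 0, h > 1 and (2ηh − 2η)/(δηh(ηh + δ)) < 1, then every complex root of
the characteristic polynomial λ³ + (ηh + δ)λ² + δηhλ + 2η(h − 1) of the Jacobian of the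
uncontrolled plasma perturbation system at E₂,₃ = (0, ±√(h − 1), 1) has negative real
part: E₂,₃ are stable under this condition. -/
theorem stmt_12 (δ η h : ℝ) (hδ : 0 < δ) (hη : 0 < η) (hh0 : 0 < h) (hh : 1 < h)
    (hcond : (2 * η * h - 2 * η) / (δ * (η * h) * (η * h + δ)) < 1) :
    ∀ z : ℂ, z ^ 3 + ((η * h + δ : ℝ) : ℂ) * z ^ 2 + ((δ * η * h : ℝ) : ℂ) * z
        + ((2 * η * (h - 1) : ℝ) : ℂ) = 0 →
      z.re < 0 := by
  intro z hz
  rw [div_lt_one (by positivity)] at hcond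
  exact re_neg_of_cubic_eq_zero_s12 (by positivity) (by positivity)
    (mul_pos (by positivity) (sub_pos.mpr hh)) (by linarith) hz
end
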